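/- arXiv:0705.4364 — 6 statements merged into one kernel-verified Lean document; each statement's English description precedes it below -/
import Mathlib

section
/- Let X̄ = (X̄₁,…,X̄_k) be a k-vector field on M̄ and let ψ̄ : ℝᵏ → M̄, ψ̄(t) = (t, ψ̄ⁱ(t), ψ̄^A_i(t)), be an integral section of X̄ which is a section of the projection M̄ → ℝᵏ. Then ψ̄ solves the Hamilton–de Donder–Weyl equations for ℋ if and only if X̄ satisfies the k-cosymplectic Hamiltonian field equations at every point of the image of ψ̄, i.e. for every t: (X̄_A)^B(ψ̄(t)) = δ_A^B, (∂ℋ/∂p^A_i)(ψ̄(t)) = (X̄_A)ⁱ(ψ̄(t)) and (∂ℋ/∂qⁱ)(ψ̄(t)) = −∑_{A=1}^k (X̄_A)^A_i(ψ̄(t)). In particular, every such integral section of a k-vector field X̄ ∈ 𝔛ᵏ_ℋ(M̄) solves the HDW equations. -/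
/- k-cosymplectic Hamiltonian formalism in canonical coordinates on
   M̄ = (Fin k → ℝ) × ((Fin n → ℝ) × (Fin k → Fin n → ℝ)),
   with coordinates (t^A, qⁱ, p^A_i). -/

/-- The coordinate direction ∂/∂qⁱ in M̄. -/
noncomputable def dqBar (n k : ℕ) (i : Fin n) :
    (Fin k → ℝ) × ((Fin n → ℝ) × (Fin k → Fin n → ℝ)) :=
  (0, Pi.single i 1, 0)

/-- The coordinate direction ∂/∂p^A_i in M̄. -/
noncomputable def dpBar (n k : ℕ) (A : Fin k) (i : Fin n) :
    (Fin k → ℝ) × ((Fin n → ℝ) × (Fin k → Fin n → ℝ)) :=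
  (0, 0, Pi.single A (Pi.single i 1))

/-- A section ψ̄ of the projection M̄ → ℝᵏ solves the Hamilton–de Donder–Weyl
equations for ℋ. -/
def SolvesHDWBar {n k : ℕ}
    (ℋ : (Fin k → ℝ) × ((Fin n → ℝ) × (Fin k → Fin n → ℝ)) → ℝ)
    (ψ : (Fin k → ℝ) → (Fin k → ℝ) × ((Fin n → ℝ) × (Fin k → Fin n → ℝ))) : Prop :=
  (∀ t i, fderiv ℝ ℋ (ψ t) (dqBar n k i) =
      - ∑ A : Fin k, (fderiv ℝ ψ t (Pi.single A 1)).2.2 A i) ∧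
  (∀ t i (A : Fin k), fderiv ℝ ℋ (ψ t) (dpBar n k A i) =
      (fderiv ℝ ψ t (Pi.single A 1)).2.1 i)

/-- The k-vector field X̄ on M̄ satisfies the k-cosymplectic Hamiltonian field
equations at the point z̄. -/
def FieldEqsBarAt {n k : ℕ}
    (ℋ : (Fin k → ℝ) × ((Fin n → ℝ) × (Fin k → Fin n → ℝ)) → ℝ)
    (X : Fin k → (Fin k → ℝ) × ((Fin n → ℝ) × (Fin k → Fin n → ℝ)) →
      (Fin k → ℝ) × ((Fin n → ℝ) × (Fin k → Fin n → ℝ)))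
    (z : (Fin k → ℝ) × ((Fin n → ℝ) × (Fin k → Fin n → ℝ))) : Prop :=
  (∀ A B : Fin k, (X A z).1 B = if A = B then 1 else 0) ∧
  (∀ i (A : Fin k), fderiv ℝ ℋ z (dpBar n k A i) = (X A z).2.1 i) ∧
  (∀ i, fderiv ℝ ℋ z (dqBar n k i) = - ∑ A : Fin k, (X A z).2.2 A i)

theorem hdw_iff_field_eqs_on_image_cosymplectic
    {n k : ℕ} (hn : 0 < n) (hk : 0 < k)
    (ℋ : (Fin k → ℝ) × ((Fin n → ℝ) × (Fin k → Fin n → ℝ)) → ℝ)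
    (hℋ : ContDiff ℝ (⊤ : ℕ∞) ℋ)
    (X : Fin k → (Fin k → ℝ) × ((Fin n → ℝ) × (Fin k → Fin n → ℝ)) →
      (Fin k → ℝ) × ((Fin n → ℝ) × (Fin k → Fin n → ℝ)))
    (hX : ∀ A, ContDiff ℝ (⊤ : ℕ∞) (X A))
    (ψ : (Fin k → ℝ) → (Fin k → ℝ) × ((Fin n → ℝ) × (Fin k → Fin n → ℝ)))
    (hψ : ContDiff ℝ (⊤ : ℕ∞) ψ)
    (hsec : ∀ t, (ψ t).1 = t)
    (hint : ∀ t (A : Fin k), fderiv ℝ ψ t (Pi.single A 1) = X A (ψ t)) :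
    SolvesHDWBar ℋ ψ ↔ ∀ t : Fin k → ℝ, FieldEqsBarAt ℋ X (ψ t) := by
  have hfst : ∀ (t : Fin k → ℝ) (A B : Fin k), (X A (ψ t)).1 B = if A = B then 1 else 0 := by
    intro t A B
    have hψt : HasFDerivAt ψ (fderiv ℝ ψ t) t :=
      (hψ.differentiable (by simp) t).hasFDerivAt
    have hid : HasFDerivAt (fun s => (ψ s).1) (ContinuousLinearMap.id ℝ (Fin k → ℝ)) t := by
      simp only [hsec]
      exact hasFDerivAt_id t
    have h := DFunLike.congr_fun (hψt.fst.unique hid) (Pi.single A 1)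
    have h' : (X A (ψ t)).1 = Pi.single A 1 := by
      rw [← hint t A]
      exact h
    rw [h', Pi.single_apply]
    simp only [eq_comm]
  simp only [SolvesHDWBar, FieldEqsBarAt, hint]
  exact ⟨fun h t => ⟨hfst t, h.2 t, h.1 t⟩, fun h => ⟨fun t => (h t).2.2, fun t => (h t).2.1⟩⟩
end

section
/- Let H : M → ℝ be smooth, ℋ : M̄ → ℝ given by ℋ(t, z) = H(z), and let X = (X₁,…,X_k) ∈ 𝔛ᵏ_H(M). Define the suspension X̄ = (X̄₁,…,X̄_k) by X̄_A(t, z) = (e_A, X_A(z)), where e_A is the A-th standard basis vector of ℝᵏ. Then X̄ ∈ 𝔛ᵏ_ℋ(M̄), i.e. X̄ satisfies the k-cosymplectic Hamiltonian field equations at every point of M̄. Moreover, X is integrable if and only if X̄ is integrable. -/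
/- M = (Fin n → ℝ) × (Fin k → Fin n → ℝ), M̄ = (Fin k → ℝ) × M. -/

/-- The coordinate direction ∂/∂qⁱ in M. -/
noncomputable def dq (n k : ℕ) (i : Fin n) : (Fin n → ℝ) × (Fin k → Fin n → ℝ) :=
  (Pi.single i 1, 0)

/-- The coordinate direction ∂/∂p^A_i in M. -/
noncomputable def dp (n k : ℕ) (A : Fin k) (i : Fin n) :
    (Fin n → ℝ) × (Fin k → Fin n → ℝ) :=
  (0, Pi.single A (Pi.single i 1))

/-- X satisfies the k-symplectic Hamiltonian field equations at z. -/
def FieldEqsAt {n k : ℕ} (H : (Fin n → ℝ) × (Fin k → Fin n → ℝ) → ℝ)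
    (X : Fin k → (Fin n → ℝ) × (Fin k → Fin n → ℝ) → (Fin n → ℝ) × (Fin k → Fin n → ℝ))
    (z : (Fin n → ℝ) × (Fin k → Fin n → ℝ)) : Prop :=
  (∀ i, fderiv ℝ H z (dq n k i) = - ∑ A : Fin k, (X A z).2 A i) ∧
  (∀ i (A : Fin k), fderiv ℝ H z (dp n k A i) = (X A z).1 i)

/-- Integral section of a k-vector field on a space E, on an open set U. -/
def IsIntegralSecOn {k : ℕ} {E : Type*} [NormedAddCommGroup E] [NormedSpace ℝ E]
    (Y : Fin k → E → E) (φ : (Fin k → ℝ) → E) (U : Set (Fin k → ℝ)) : Prop :=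
  ContDiffOn ℝ (⊤ : ℕ∞) φ U ∧ ∀ t ∈ U, ∀ A : Fin k, fderiv ℝ φ t (Pi.single A 1) = Y A (φ t)

/-- A k-vector field is integrable if an integral section defined on a neighborhood
of 0 ∈ ℝᵏ passes through every point. -/
def IsIntegrable {k : ℕ} {E : Type*} [NormedAddCommGroup E] [NormedSpace ℝ E]
    (Y : Fin k → E → E) : Prop :=
  ∀ z : E, ∃ U : Set (Fin k → ℝ), IsOpen U ∧ (0 : Fin k → ℝ) ∈ U ∧
    ∃ φ : (Fin k → ℝ) → E, IsIntegralSecOn Y φ U ∧ φ 0 = z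

/-- The derivative of a function pulled back along the second projection. -/
lemma fderiv_comp_snd_apply {F E G : Type*} [NormedAddCommGroup F] [NormedSpace ℝ F]
    [NormedAddCommGroup E] [NormedSpace ℝ E] [NormedAddCommGroup G] [NormedSpace ℝ G]
    {f : E → G} {w : F × E} (hf : DifferentiableAt ℝ f w.2) (v : F × E) :
    fderiv ℝ (fun w : F × E => f w.2) w v = fderiv ℝ f w.2 v.2 := by
  have h : HasFDerivAt (fun w : F × E => f w.2)
      ((fderiv ℝ f w.2).comp (ContinuousLinearMap.snd ℝ F E)) w :=
    hf.hasFDerivAt.comp w hasFDerivAt_snd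
  rw [h.fderiv]
  rfl

lemma IsIntegralSecOn.differentiableAt {k : ℕ} {E : Type*} [NormedAddCommGroup E]
    [NormedSpace ℝ E] {Y : Fin k → E → E} {φ : (Fin k → ℝ) → E} {U : Set (Fin k → ℝ)}
    (h : IsIntegralSecOn Y φ U) (hU : IsOpen U) {t : Fin k → ℝ} (ht : t ∈ U) :
    DifferentiableAt ℝ φ t :=
  (h.1.contDiffAt (hU.mem_nhds ht)).differentiableAt (by simp)

/-- An integral section lifts to the suspension by adjoining a translate of the identity. -/
lemma IsIntegralSecOn.suspension {k : ℕ} {E : Type*} [NormedAddCommGroup E]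
    [NormedSpace ℝ E] {Y : Fin k → E → E} {φ : (Fin k → ℝ) → E} {U : Set (Fin k → ℝ)}
    (h : IsIntegralSecOn Y φ U) (hU : IsOpen U) (s : Fin k → ℝ) :
    IsIntegralSecOn (fun A (w : (Fin k → ℝ) × E) => ((Pi.single A 1 : Fin k → ℝ), Y A w.2))
      (fun t => (t + s, φ t)) U := by
  refine ⟨(contDiff_id.add contDiff_const).contDiffOn.prodMk h.1, fun t ht A => ?_⟩
  have hd : HasFDerivAt (fun t => (t + s, φ t))
      ((ContinuousLinearMap.id ℝ (Fin k → ℝ)).prod (fderiv ℝ φ t)) t :=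
    ((hasFDerivAt_id t).add_const s).prodMk (h.differentiableAt hU ht).hasFDerivAt
  rw [hd.fderiv]
  simp [h.2 t ht A]

/-- An integral section of the suspension projects to an integral section. -/
lemma IsIntegralSecOn.snd_of_suspension {k : ℕ} {E : Type*} [NormedAddCommGroup E]
    [NormedSpace ℝ E] {Y : Fin k → E → E} {ψ : (Fin k → ℝ) → (Fin k → ℝ) × E}
    {U : Set (Fin k → ℝ)}
    (h : IsIntegralSecOn
      (fun A (w : (Fin k → ℝ) × E) => ((Pi.single A 1 : Fin k → ℝ), Y A w.2)) ψ U)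
    (hU : IsOpen U) : IsIntegralSecOn Y (fun t => (ψ t).2) U := by
  refine ⟨h.1.snd, fun t ht A => ?_⟩
  rw [fderiv.snd (h.differentiableAt hU ht)]
  exact congrArg Prod.snd (h.2 t ht A)

lemma isIntegrable_suspension_iff {k : ℕ} {E : Type*} [NormedAddCommGroup E]
    [NormedSpace ℝ E] (Y : Fin k → E → E) :
    IsIntegrable Y ↔ IsIntegrable
      (fun A (w : (Fin k → ℝ) × E) => ((Pi.single A 1 : Fin k → ℝ), Y A w.2)) := by
  constructor
  · rintro h ⟨s, z⟩
    obtain ⟨U, hU, h0, φ, hφ, hz⟩ := h z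
    exact ⟨U, hU, h0, _, hφ.suspension hU s, by simp [hz]⟩
  · intro h z
    obtain ⟨U, hU, h0, ψ, hψ, hz⟩ := h (0, z)
    exact ⟨U, hU, h0, _, hψ.snd_of_suspension hU, by simp [hz]⟩

theorem suspension_field_eqs_and_integrability
    {n k : ℕ} (hn : 0 < n) (hk : 0 < k)
    (H : (Fin n → ℝ) × (Fin k → Fin n → ℝ) → ℝ) (hH : ContDiff ℝ (⊤ : ℕ∞) H)
    (X : Fin k → (Fin n → ℝ) × (Fin k → Fin n → ℝ) → (Fin n → ℝ) × (Fin k → Fin n → ℝ))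
    (hX : ∀ A, ContDiff ℝ (⊤ : ℕ∞) (X A))
    (hXH : ∀ z, FieldEqsAt H X z) :
    (∀ zb : (Fin k → ℝ) × ((Fin n → ℝ) × (Fin k → Fin n → ℝ)),
       FieldEqsBarAt (n := n) (k := k) (fun w => H w.2)
         (fun A w => (Pi.single A 1, X A w.2)) zb) ∧
    (IsIntegrable X ↔
       IsIntegrable (fun A (w : (Fin k → ℝ) × ((Fin n → ℝ) × (Fin k → Fin n → ℝ))) =>
         ((Pi.single A 1 : Fin k → ℝ), X A w.2))) := by
  refine ⟨fun zb => ⟨fun A B => ?_, fun i A => ?_, fun i => ?_⟩, isIntegrable_suspension_iff X⟩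
  · simp [Pi.single_apply, eq_comm]
  · rw [fderiv_comp_snd_apply (hH.differentiable (by simp) _)]
    exact (hXH zb.2).2 i A
  · rw [fderiv_comp_snd_apply (hH.differentiable (by simp) _)]
    exact (hXH zb.2).1 i
end

section
/- Suppose L is regular. Let Γ = (Γ₁,…,Γ_k) be a k-vector field on N and let (q, v) ∈ N be a point at which, for every j and B, ∑_{A=1}^k ∑_{i=1}^n (∂²L/∂v^j_B ∂v^i_A)(q, v) · (Γ_A)ⁱ(q, v) = ∑_{A=1}^k ∑_{i=1}^n (∂²L/∂v^j_B ∂v^i_A)(q, v) · v^i_A. Then (Γ_A)ⁱ(q, v) = v^i_A for all i and A; i.e. every k-vector field solving the coordinate Lagrangian field equations of a regular Lagrangian satisfies the SOPDE condition. -/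
/- N = (Fin n → ℝ) × (Fin k → Fin n → ℝ), the model of T¹ₖℝⁿ with
   coordinates (qⁱ, v^i_A); z.2 A i is the coordinate v^i_A. -/

/-- The coordinate direction ∂/∂v^i_A in N. -/
noncomputable def dv (n k : ℕ) (i : Fin n) (A : Fin k) :
    (Fin n → ℝ) × (Fin k → Fin n → ℝ) :=
  (0, Pi.single A (Pi.single i 1))

/-- The second partial derivative ∂²L/∂v^j_B ∂v^i_A of L at z. -/
noncomputable def d2vv {n k : ℕ} (L : (Fin n → ℝ) × (Fin k → Fin n → ℝ) → ℝ)
    (z : (Fin n → ℝ) × (Fin k → Fin n → ℝ)) (j : Fin n) (B : Fin k)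
    (i : Fin n) (A : Fin k) : ℝ :=
  fderiv ℝ (fun w => fderiv ℝ L w (dv n k i A)) z (dv n k j B)

/-- L is regular: the nk × nk velocity Hessian is invertible at every point. -/
def RegularLag {n k : ℕ} (L : (Fin n → ℝ) × (Fin k → Fin n → ℝ) → ℝ) : Prop :=
  ∀ z, IsUnit (Matrix.of fun p q : Fin n × Fin k =>
    d2vv L z p.1 p.2 q.1 q.2)

theorem regular_lagrangian_field_eqs_sopde
    {n k : ℕ} (hn : 0 < n) (hk : 0 < k)
    (L : (Fin n → ℝ) × (Fin k → Fin n → ℝ) → ℝ) (hL : ContDiff ℝ (⊤ : ℕ∞) L)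
    (hreg : RegularLag L)
    (Γ : Fin k → (Fin n → ℝ) × (Fin k → Fin n → ℝ) → (Fin n → ℝ) × (Fin k → Fin n → ℝ))
    (hΓ : ∀ A, ContDiff ℝ (⊤ : ℕ∞) (Γ A))
    (z : (Fin n → ℝ) × (Fin k → Fin n → ℝ))
    (heq : ∀ (j : Fin n) (B : Fin k),
      ∑ A : Fin k, ∑ i : Fin n, d2vv L z j B i A * (Γ A z).1 i =
        ∑ A : Fin k, ∑ i : Fin n, d2vv L z j B i A * z.2 A i) :
    ∀ (i : Fin n) (A : Fin k), (Γ A z).1 i = z.2 A i := by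
  intro i A
  have h := Matrix.mulVec_injective_of_isUnit (hreg z)
    (a₁ := fun p : Fin n × Fin k => (Γ p.2 z).1 p.1) (a₂ := fun p => z.2 p.2 p.1) <| by
      ext ⟨j, B⟩
      simpa only [Matrix.mulVec, dotProduct, Matrix.of_apply, Fintype.sum_prod_type_right]
        using heq j B
  exact congrFun h (i, A)
end

section
/- Let Γ = (Γ₁,…,Γ_k) be a SOPDE k-vector field on N, i.e. (Γ_A)ⁱ(q, v) = v^i_A at every point, and suppose that at every point (q, v) ∈ N and for every i: ∑_{A=1}^k ∑_{j=1}^n (∂²L/∂qʲ ∂v^i_A)(q, v) · v^j_A + ∑_{A,B=1}^k ∑_{j=1}^n (∂²L/∂v^j_B ∂v^i_A)(q, v) · (Γ_A)^j_B(q, v) = (∂L/∂qⁱ)(q, v). Then every integral section φ : U → N of Γ, φ(t) = (φⁱ(t), φ^i_A(t)), is holonomic, i.e. φ^i_A(t) = (∂φⁱ/∂t^A)(t), and solves the Euler–Lagrange equations: for all t ∈ U and all i, ∑_{A=1}^k (∂/∂t^A)[ (∂L/∂v^i_A)(φ(t)) ] = (∂L/∂qⁱ)(φ(t)). -/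
/-- The second partial derivative ∂²L/∂qʲ ∂v^i_A of L at z. -/
noncomputable def d2qv {n k : ℕ} (L : (Fin n → ℝ) × (Fin k → Fin n → ℝ) → ℝ)
    (z : (Fin n → ℝ) × (Fin k → Fin n → ℝ)) (j : Fin n) (i : Fin n) (A : Fin k) : ℝ :=
  fderiv ℝ (fun w => fderiv ℝ L w (dv n k i A)) z (dq n k j)

/-- Every vector of N is the combination of the coordinate directions with its coordinates. -/
theorem eq_sum_dq_add_sum_dv {n k : ℕ} (w : (Fin n → ℝ) × (Fin k → Fin n → ℝ)) :
    w = ∑ j : Fin n, w.1 j • dq n k j +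
      ∑ B : Fin k, ∑ j : Fin n, w.2 B j • dv n k j B := by
  ext
  · simp [dq, dv, Prod.fst_sum, Finset.sum_apply, Pi.single_apply]
  · simp [dq, dv, Prod.snd_sum, Finset.sum_apply, Pi.single_apply]

/-- A linear functional on N in terms of its values on the coordinate directions. -/
theorem apply_eq_sum_dq_add_sum_dv {n k : ℕ}
    (f : (Fin n → ℝ) × (Fin k → Fin n → ℝ) →L[ℝ] ℝ)
    (w : (Fin n → ℝ) × (Fin k → Fin n → ℝ)) :
    f w = ∑ j : Fin n, f (dq n k j) * w.1 j +
      ∑ B : Fin k, ∑ j : Fin n, f (dv n k j B) * w.2 B j := by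
  conv_lhs => rw [eq_sum_dq_add_sum_dv w]
  simp only [map_add, map_sum, map_smul, smul_eq_mul, mul_comm]

theorem sopde_integral_sections_holonomic_and_euler_lagrange
    {n k : ℕ} (hn : 0 < n) (hk : 0 < k)
    (L : (Fin n → ℝ) × (Fin k → Fin n → ℝ) → ℝ) (hL : ContDiff ℝ (⊤ : ℕ∞) L)
    (Γ : Fin k → (Fin n → ℝ) × (Fin k → Fin n → ℝ) → (Fin n → ℝ) × (Fin k → Fin n → ℝ))
    (hΓ : ∀ A, ContDiff ℝ (⊤ : ℕ∞) (Γ A))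
    (hsopde : ∀ z (i : Fin n) (A : Fin k), (Γ A z).1 i = z.2 A i)
    (heq : ∀ z (i : Fin n),
      (∑ A : Fin k, ∑ j : Fin n, d2qv L z j i A * z.2 A j) +
        (∑ A : Fin k, ∑ B : Fin k, ∑ j : Fin n, d2vv L z j B i A * (Γ A z).2 B j) =
        fderiv ℝ L z (dq n k i))
    (U : Set (Fin k → ℝ)) (hU : IsOpen U)
    (φ : (Fin k → ℝ) → (Fin n → ℝ) × (Fin k → Fin n → ℝ))
    (hφ : ContDiffOn ℝ (⊤ : ℕ∞) φ U)
    (hint : ∀ t ∈ U, ∀ A : Fin k, fderiv ℝ φ t (Pi.single A 1) = Γ A (φ t)) :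
    (∀ t ∈ U, ∀ (i : Fin n) (A : Fin k),
      (φ t).2 A i = (fderiv ℝ φ t (Pi.single A 1)).1 i) ∧
    (∀ t ∈ U, ∀ i : Fin n,
      ∑ A : Fin k,
          fderiv ℝ (fun s => fderiv ℝ L (φ s) (dv n k i A)) t (Pi.single A 1) =
        fderiv ℝ L (φ t) (dq n k i)) := by
  refine ⟨fun t ht i A => by rw [hint t ht A, hsopde], fun t ht i => ?_⟩
  have hφt : DifferentiableAt ℝ φ t :=
    (hφ.contDiffAt (hU.mem_nhds ht)).differentiableAt (by simp)
  have hdL : Differentiable ℝ (fderiv ℝ L) :=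
    (hL.fderiv_right (m := (⊤ : ℕ∞)) (by simp)).differentiable (by simp)
  rw [← heq (φ t) i, ← Finset.sum_add_distrib]
  refine Finset.sum_congr rfl fun A _ => ?_
  have hp : DifferentiableAt ℝ (fun w => fderiv ℝ L w (dv n k i A)) (φ t) :=
    (hdL (φ t)).clm_apply (differentiableAt_const _)
  have hchain : fderiv ℝ (fun s => fderiv ℝ L (φ s) (dv n k i A)) t =
      (fderiv ℝ (fun w => fderiv ℝ L w (dv n k i A)) (φ t)).comp (fderiv ℝ φ t) :=
    fderiv_comp t hp hφt
  rw [hchain, ContinuousLinearMap.comp_apply, hint t ht A, apply_eq_sum_dq_add_sum_dv]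
  simp only [d2qv, d2vv, hsopde]
end

section
/- Suppose ℒ : N̄ → ℝ is regular and let Γ̄ = (Γ̄₁,…,Γ̄_k) be a k-vector field on N̄ satisfying, at every point z̄ = (t, q, v): (Γ̄_A)^B(z̄) = δ_A^B and, for every j and B, ∑_{A=1}^k ∑_{i=1}^n (∂²ℒ/∂v^j_B ∂v^i_A)(z̄) · (Γ̄_A)ⁱ(z̄) = ∑_{A=1}^k ∑_{i=1}^n (∂²ℒ/∂v^j_B ∂v^i_A)(z̄) · v^i_A. Then Γ̄ is a SOPDE: (Γ̄_A)ⁱ(z̄) = v^i_A for all i, A. If moreover Γ̄ satisfies at every point, for every i, ∑_{A=1}^k [ (∂²ℒ/∂t^A ∂v^i_A)(z̄) + ∑_{j=1}^n v^j_A (∂²ℒ/∂qʲ ∂v^i_A)(z̄) + ∑_{B=1}^k ∑_{j=1}^n (Γ̄_A)^j_B(z̄) (∂²ℒ/∂v^j_B ∂v^i_A)(z̄) ] = (∂ℒ/∂qⁱ)(z̄), then every integral section ψ̄ of Γ̄ of the form ψ̄(t) = (t, ψⁱ(t), ψ^i_A(t)) is holonomic, ψ^i_A(t) = (∂ψⁱ/∂t^A)(t),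 and solves the Euler–Lagrange equations: ∑_{A=1}^k (∂/∂t^A)[ (∂ℒ/∂v^i_A)(ψ̄(t)) ] = (∂ℒ/∂qⁱ)(ψ̄(t)) for all i. -/
/- N̄ = (Fin k → ℝ) × ((Fin n → ℝ) × (Fin k → Fin n → ℝ)), the model of
   ℝᵏ × T¹ₖℝⁿ with coordinates (t^A, qⁱ, v^i_A); zb.2.2 A i is v^i_A. -/

/-- The coordinate direction ∂/∂t^A in N̄. -/
noncomputable def dtBar (n k : ℕ) (A : Fin k) :
    (Fin k → ℝ) × ((Fin n → ℝ) × (Fin k → Fin n → ℝ)) :=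
  (Pi.single A 1, 0, 0)

/-- The coordinate direction ∂/∂v^i_A in N̄. -/
noncomputable def dvBar (n k : ℕ) (i : Fin n) (A : Fin k) :
    (Fin k → ℝ) × ((Fin n → ℝ) × (Fin k → Fin n → ℝ)) :=
  (0, 0, Pi.single A (Pi.single i 1))

/-- The second partial derivative ∂²ℒ/∂t^B ∂v^i_A of ℒ at zb. -/
noncomputable def d2tvBar {n k : ℕ}
    (ℒ : (Fin k → ℝ) × ((Fin n → ℝ) × (Fin k → Fin n → ℝ)) → ℝ)
    (zb : (Fin k → ℝ) × ((Fin n → ℝ) × (Fin k → Fin n → ℝ)))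
    (B : Fin k) (i : Fin n) (A : Fin k) : ℝ :=
  fderiv ℝ (fun w => fderiv ℝ ℒ w (dvBar n k i A)) zb (dtBar n k B)

/-- The second partial derivative ∂²ℒ/∂qʲ ∂v^i_A of ℒ at zb. -/
noncomputable def d2qvBar {n k : ℕ}
    (ℒ : (Fin k → ℝ) × ((Fin n → ℝ) × (Fin k → Fin n → ℝ)) → ℝ)
    (zb : (Fin k → ℝ) × ((Fin n → ℝ) × (Fin k → Fin n → ℝ)))
    (j : Fin n) (i : Fin n) (A : Fin k) : ℝ :=
  fderiv ℝ (fun w => fderiv ℝ ℒ w (dvBar n k i A)) zb (dqBar n k j)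

/-- The second partial derivative ∂²ℒ/∂v^j_B ∂v^i_A of ℒ at zb. -/
noncomputable def d2vvBar {n k : ℕ}
    (ℒ : (Fin k → ℝ) × ((Fin n → ℝ) × (Fin k → Fin n → ℝ)) → ℝ)
    (zb : (Fin k → ℝ) × ((Fin n → ℝ) × (Fin k → Fin n → ℝ)))
    (j : Fin n) (B : Fin k) (i : Fin n) (A : Fin k) : ℝ :=
  fderiv ℝ (fun w => fderiv ℝ ℒ w (dvBar n k i A)) zb (dvBar n k j B)

/-- ℒ is regular: the nk × nk velocity Hessian is invertible at every point. -/
def RegularLagBar {n k : ℕ}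
    (ℒ : (Fin k → ℝ) × ((Fin n → ℝ) × (Fin k → Fin n → ℝ)) → ℝ) : Prop :=
  ∀ zb, IsUnit (Matrix.of fun p q : Fin n × Fin k => d2vvBar ℒ zb p.1 p.2 q.1 q.2)

/-- Coordinate expansion of a vector of N̄ in the directions ∂/∂t^A, ∂/∂qⁱ, ∂/∂v^i_A. -/
theorem sum_coord_directions_eq {n k : ℕ}
    (w : (Fin k → ℝ) × ((Fin n → ℝ) × (Fin k → Fin n → ℝ))) :
    (∑ B, w.1 B • dtBar n k B) + (∑ j, w.2.1 j • dqBar n k j) +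
      (∑ B, ∑ j, w.2.2 B j • dvBar n k j B) = w := by
  refine Prod.ext ?_ (Prod.ext ?_ ?_)
  · ext C
    simp [dtBar, dqBar, dvBar, Prod.fst_sum, Finset.sum_apply, Pi.single_apply]
  · ext l
    simp [dtBar, dqBar, dvBar, Prod.fst_sum, Prod.snd_sum, Finset.sum_apply, Pi.single_apply]
  · ext C l
    simp [dtBar, dqBar, dvBar, Prod.snd_sum, Finset.sum_apply, Pi.single_apply,
      Finset.sum_ite_irrel]

/-- The velocity Hessian of a regular Lagrangian is left-cancellable. -/
theorem RegularLagBar.velocity_hessian_cancel {n k : ℕ}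
    {ℒ : (Fin k → ℝ) × ((Fin n → ℝ) × (Fin k → Fin n → ℝ)) → ℝ} (hreg : RegularLagBar ℒ)
    (zb : (Fin k → ℝ) × ((Fin n → ℝ) × (Fin k → Fin n → ℝ))) {x y : Fin k → Fin n → ℝ}
    (h : ∀ (j : Fin n) (B : Fin k),
      ∑ A : Fin k, ∑ i : Fin n, d2vvBar ℒ zb j B i A * x A i =
        ∑ A : Fin k, ∑ i : Fin n, d2vvBar ℒ zb j B i A * y A i) : x = y := by
  have hinj := Matrix.mulVec_injective_of_isUnit (hreg zb)
  have hxy : (fun p : Fin n × Fin k => x p.2 p.1) = fun p => y p.2 p.1 := by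
    apply hinj
    ext ⟨j, B⟩
    simpa [Matrix.mulVec, dotProduct, Fintype.sum_prod_type_right] using h j B
  ext A i
  exact congrFun hxy (i, A)

theorem cosymplectic_lagrangian_sopde_and_euler_lagrange
    {n k : ℕ} (hn : 0 < n) (hk : 0 < k)
    (ℒ : (Fin k → ℝ) × ((Fin n → ℝ) × (Fin k → Fin n → ℝ)) → ℝ)
    (hℒ : ContDiff ℝ (⊤ : ℕ∞) ℒ) (hreg : RegularLagBar ℒ)
    (Γ : Fin k → (Fin k → ℝ) × ((Fin n → ℝ) × (Fin k → Fin n → ℝ)) →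
      (Fin k → ℝ) × ((Fin n → ℝ) × (Fin k → Fin n → ℝ)))
    (hΓ : ∀ A, ContDiff ℝ (⊤ : ℕ∞) (Γ A))
    (hδ : ∀ zb (A B : Fin k), (Γ A zb).1 B = if A = B then 1 else 0)
    (heq1 : ∀ zb (j : Fin n) (B : Fin k),
      ∑ A : Fin k, ∑ i : Fin n, d2vvBar ℒ zb j B i A * (Γ A zb).2.1 i =
        ∑ A : Fin k, ∑ i : Fin n, d2vvBar ℒ zb j B i A * zb.2.2 A i) :
    (∀ zb (i : Fin n) (A : Fin k), (Γ A zb).2.1 i = zb.2.2 A i) ∧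
    ((∀ zb (i : Fin n),
        ∑ A : Fin k,
          (d2tvBar ℒ zb A i A +
            (∑ j : Fin n, zb.2.2 A j * d2qvBar ℒ zb j i A) +
            (∑ B : Fin k, ∑ j : Fin n, (Γ A zb).2.2 B j * d2vvBar ℒ zb j B i A)) =
          fderiv ℝ ℒ zb (dqBar n k i)) →
      ∀ (U : Set (Fin k → ℝ)), IsOpen U →
        ∀ ψ : (Fin k → ℝ) → (Fin k → ℝ) × ((Fin n → ℝ) × (Fin k → Fin n → ℝ)),
          ContDiffOn ℝ (⊤ : ℕ∞) ψ U →
          (∀ t ∈ U, (ψ t).1 = t) →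
          (∀ t ∈ U, ∀ A : Fin k, fderiv ℝ ψ t (Pi.single A 1) = Γ A (ψ t)) →
          (∀ t ∈ U, ∀ (i : Fin n) (A : Fin k),
            (ψ t).2.2 A i = (fderiv ℝ ψ t (Pi.single A 1)).2.1 i) ∧
          (∀ t ∈ U, ∀ i : Fin n,
            ∑ A : Fin k,
                fderiv ℝ (fun s => fderiv ℝ ℒ (ψ s) (dvBar n k i A)) t
                  (Pi.single A 1) =
              fderiv ℝ ℒ (ψ t) (dqBar n k i))) := by
  have hsopde : ∀ zb (i : Fin n) (A : Fin k), (Γ A zb).2.1 i = zb.2.2 A i := fun zb i A =>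
    congrFun (congrFun
      (hreg.velocity_hessian_cancel zb (x := fun A => (Γ A zb).2.1) (heq1 zb)) A) i
  refine ⟨hsopde, fun heq2 U hU ψ hψ _ hint => ⟨fun t ht i A => ?_, fun t ht i => ?_⟩⟩
  · rw [hint t ht A, hsopde]
  · rw [← heq2 (ψ t) i]
    refine Finset.sum_congr rfl fun A _ => ?_
    have hψt : DifferentiableAt ℝ ψ t :=
      (hψ.contDiffAt (hU.mem_nhds ht)).differentiableAt (by simp)
    have hg : Differentiable ℝ (fun w => fderiv ℝ ℒ w (dvBar n k i A)) :=
      ((hℒ.fderiv_right (m := 1) (by norm_cast)).differentiable (by simp)).clm_apply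
        (differentiable_const _)
    have hchain := fderiv_comp t (hg (ψ t)) hψt
    rw [Function.comp_def] at hchain
    rw [hchain, ContinuousLinearMap.comp_apply, hint t ht A]
    conv_lhs => rw [← sum_coord_directions_eq (Γ A (ψ t))]
    simp only [map_add, map_sum, map_smul, smul_eq_mul, hδ, hsopde, ite_mul, one_mul, zero_mul,
      Finset.sum_ite_eq, Finset.mem_univ, if_true, d2tvBar, d2qvBar, d2vvBar]
end

section
/- The linear map Φ : W → ℝ × (Fin k → V*), defined by Φ(α) = ( α(ê₁,…,ê_k), A ↦ (v ↦ α(ê₁,…,ê_{A−1}, (0, v), ê_{A+1},…,ê_k)) ), is a linear isomorphism. (This is the fiberwise content of the statement that the extended multimomentum bundle ℳπ = Λ₂ᵏT*(ℝᵏ × Q) is diffeomorphic to ℝᵏ × ℝ × (T¹ₖ)*Q for the trivial bundle ℝᵏ × Q → ℝᵏ.) -/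
/-- The subspace W of alternating k-linear maps α : (ℝᵏ × V)ᵏ → ℝ which vanish
whenever at least two of their arguments lie in the vertical subspace {0} × V. -/
noncomputable def Wsub (k : ℕ) (V : Type*) [AddCommGroup V] [Module ℝ V] :
    Submodule ℝ (AlternatingMap ℝ ((Fin k → ℝ) × V) ℝ (Fin k)) where
  carrier := {α | ∀ x : Fin k → (Fin k → ℝ) × V,
    (∃ A B : Fin k, A ≠ B ∧ (x A).1 = 0 ∧ (x B).1 = 0) → α x = 0}
  add_mem' := by
    intro a b ha hb x hx
    simp [ha x hx, hb x hx]
  zero_mem' := by intro x _; simp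
  smul_mem' := by
    intro c a ha x hx
    simp [ha x hx]

/-- ê_B = (e_B, 0), with (e₁,…,e_k) the standard basis of ℝᵏ. -/
noncomputable def ehat (k : ℕ) (V : Type*) [AddCommGroup V] [Module ℝ V]
    (B : Fin k) : (Fin k → ℝ) × V :=
  (Pi.single B 1, 0)

open Function in
/-- An alternating map in `Wsub k V` is determined by its values on `(ê₁, …, ê_k)` and on the
families obtained from it by replacing one entry by a vertical vector. -/
theorem Wsub_eq_zero {k : ℕ} (hk : 0 < k) {V : Type*} [AddCommGroup V] [Module ℝ V]
    {α : AlternatingMap ℝ ((Fin k → ℝ) × V) ℝ (Fin k)} (hα : α ∈ Wsub k V)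
    (h_base : α (ehat k V) = 0)
    (h_vert : ∀ (A : Fin k) (v : V), α (update (ehat k V) A ((0 : Fin k → ℝ), v)) = 0) :
    α = 0 := by
  classical
  let bV := Module.Basis.ofVectorSpace ℝ V
  let b := (Pi.basisFun ℝ (Fin k)).prod bV
  have hb_inl (A : Fin k) : b (Sum.inl A) = ehat k V A := by
    ext <;> simp [b, ehat]
  have hb_inr (w) : b (Sum.inr w) = ((0 : Fin k → ℝ), bV w) := by
    ext <;> simp [b]
  refine b.ext_alternating fun v hv => ?_
  rw [AlternatingMap.zero_apply]
  by_cases hvert : ∃ i j, i ≠ j ∧ (v i).isRight ∧ (v j).isRight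
  · obtain ⟨i, j, hij, hi, hj⟩ := hvert
    obtain ⟨x, hx⟩ := Sum.isRight_iff.1 hi
    obtain ⟨y, hy⟩ := Sum.isRight_iff.1 hj
    exact hα _ ⟨i, j, hij, by simp [hx, hb_inr], by simp [hy, hb_inr]⟩
  obtain ⟨i₀, hi₀⟩ : ∃ i₀, ∀ j ≠ i₀, ∃ c, v j = Sum.inl c := by
    by_cases h : ∃ i, (v i).isRight
    · obtain ⟨i, hi⟩ := h
      refine ⟨i, fun j hj => Sum.isLeft_iff.1 ?_⟩
      by_contra hl
      exact hvert ⟨j, i, hj, by simpa using hl, hi⟩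
    · refine ⟨⟨0, hk⟩, fun j _ => Sum.isLeft_iff.1 ?_⟩
      by_contra hl
      exact h ⟨j, by simpa using hl⟩
  obtain ⟨σ, hσ⟩ : ∃ σ : Equiv.Perm (Fin k), ∀ j ≠ i₀, v j = Sum.inl (σ j) := by
    choose! f hf using hi₀
    have hinj : Set.InjOn f (Finset.univ.erase i₀ : Finset (Fin k)) := by
      intro i hi j hj hij
      apply hv
      rw [hf i (by simpa using hi), hf j (by simpa using hj), hij]
    obtain ⟨g, hg⟩ := Finset.exists_equiv_extend_of_card_eq
      (t := (Finset.univ : Finset (Fin k))) (by simp) (Finset.subset_univ _) hinj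
    refine ⟨g.trans (Equiv.subtypeUnivEquiv Finset.mem_univ), fun j hj => ?_⟩
    rw [hf j hj, ← hg j (by simpa using hj)]
    rfl
  have hcomp : (fun i => b (v i)) = update (ehat k V) (σ i₀) (b (v i₀)) ∘ σ := by
    funext j
    rcases eq_or_ne j i₀ with rfl | hj
    · simp
    · simp [hσ j hj, hb_inl, hj]
  rw [hcomp, AlternatingMap.map_perm]
  rcases hvi : v i₀ with c | w
  · have hc : c = σ i₀ := by
      by_contra hne
      have hj : σ.symm c ≠ i₀ := fun h => hne (by simp [← h])
      exact hj (hv (by rw [hσ _ hj, hvi, Equiv.apply_symm_apply]))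
    rw [hb_inl, hc, update_eq_self, h_base, smul_zero]
  · rw [hb_inr, h_vert, smul_zero]

/-- The linear map `Φ` evaluating an element of `Wsub k V` on `(ê₁, …, ê_k)` and on the families
obtained from it by replacing one entry by a vertical vector. -/
noncomputable def multimomentumEval (k : ℕ) (V : Type*) [AddCommGroup V] [Module ℝ V] :
    Wsub k V →ₗ[ℝ] ℝ × (Fin k → (V →ₗ[ℝ] ℝ)) where
  toFun α := (α.1 (ehat k V), fun A =>
    (α.1.toMultilinearMap.toLinearMap (ehat k V) A).comp (LinearMap.inr ℝ (Fin k → ℝ) V))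
  map_add' α β := by ext <;> simp
  map_smul' c α := by ext <;> simp

/-- The linear map `ℝᵏ × V → ℝᵏ` sending `(t, v)` to `t` with its `A`-th coordinate replaced
by `p v`. -/
noncomputable def replaceCoord {k : ℕ} {V : Type*} [AddCommGroup V] [Module ℝ V]
    (A : Fin k) (p : V →ₗ[ℝ] ℝ) : (Fin k → ℝ) × V →ₗ[ℝ] (Fin k → ℝ) where
  toFun x := Function.update x.1 A (p x.2)
  map_add' x y := by simp [← Function.update_add]
  map_smul' c x := by simp [← Function.update_smul]

@[simp]
theorem replaceCoord_apply {k : ℕ} {V : Type*} [AddCommGroup V] [Module ℝ V]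
    (A : Fin k) (p : V →ₗ[ℝ] ℝ) (x : (Fin k → ℝ) × V) :
    replaceCoord A p x = Function.update x.1 A (p x.2) := rfl

@[simp]
theorem replaceCoord_ehat_self {k : ℕ} {V : Type*} [AddCommGroup V] [Module ℝ V]
    (A : Fin k) (p : V →ₗ[ℝ] ℝ) : replaceCoord A p (ehat k V A) = 0 := by
  ext j
  rcases eq_or_ne j A with rfl | hj <;> simp [ehat, *]

theorem replaceCoord_ehat_of_ne {k : ℕ} {V : Type*} [AddCommGroup V] [Module ℝ V]
    {A B : Fin k} (hBA : B ≠ A) (p : V →ₗ[ℝ] ℝ) :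
    replaceCoord A p (ehat k V B) = Pi.single B 1 := by
  ext j
  rcases eq_or_ne j A with rfl | hj <;> simp [ehat, hBA.symm, *]

theorem detRowAlternating_single (k : ℕ) :
    Matrix.detRowAlternating (fun i : Fin k => (Pi.single i 1 : Fin k → ℝ)) = 1 := by
  rw [← Matrix.det_one (n := Fin k) (R := ℝ)]
  congr 1
  ext i j
  simp [Matrix.one_apply, Pi.single_apply, eq_comm]

theorem detRowAlternating_comp_replaceCoord_mem_Wsub {k : ℕ} {V : Type*} [AddCommGroup V]
    [Module ℝ V] (A : Fin k) (p : V →ₗ[ℝ] ℝ) :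
    Matrix.detRowAlternating.compLinearMap (replaceCoord A p) ∈ Wsub k V := by
  rintro x ⟨i, j, hij, hi, hj⟩
  have hrow {y : (Fin k → ℝ) × V} (hy : y.1 = 0) :
      replaceCoord A p y = p y.2 • Pi.single A (1 : ℝ) := by
    ext l
    rcases eq_or_ne l A with rfl | hl <;> simp [*]
  rw [AlternatingMap.compLinearMap_apply]
  by_cases h₀ : p (x i).2 = 0
  · exact AlternatingMap.map_coord_zero _ i (by rw [hrow hi, h₀, zero_smul])
  · refine AlternatingMap.map_linearDependent _ _ fun hli => hij.symm ?_
    refine hli.eq_of_smul_apply_eq_smul_apply (p (x i).2) (p (x j).2) j i h₀ ?_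
    rw [hrow hi, hrow hj, smul_comm]

theorem detRowAlternating_comp_fst_mem_Wsub (k : ℕ) (V : Type*) [AddCommGroup V]
    [Module ℝ V] :
    Matrix.detRowAlternating.compLinearMap (LinearMap.fst ℝ (Fin k → ℝ) V) ∈ Wsub k V := by
  rintro x ⟨i, _, _, hi, _⟩
  rw [AlternatingMap.compLinearMap_apply]
  exact AlternatingMap.map_coord_zero _ i hi

theorem multimomentumEval_comp_fst (k : ℕ) (V : Type*) [AddCommGroup V] [Module ℝ V] :
    multimomentumEval k V ⟨_, detRowAlternating_comp_fst_mem_Wsub k V⟩ = (1, 0) := by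
  refine Prod.ext (detRowAlternating_single k) (funext fun B => LinearMap.ext fun v => ?_)
  exact AlternatingMap.map_coord_zero Matrix.detRowAlternating B
    (by simp)

open Function in
theorem multimomentumEval_comp_replaceCoord {k : ℕ} {V : Type*} [AddCommGroup V] [Module ℝ V]
    (A : Fin k) (p : V →ₗ[ℝ] ℝ) :
    multimomentumEval k V ⟨_, detRowAlternating_comp_replaceCoord_mem_Wsub A p⟩ =
      (0, Pi.single A p) := by
  refine Prod.ext (AlternatingMap.map_coord_zero Matrix.detRowAlternating A
    (replaceCoord_ehat_self A p)) (funext fun B => LinearMap.ext fun v => ?_)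
  change Matrix.detRowAlternating
    (fun i => replaceCoord A p (update (ehat k V) B ((0 : Fin k → ℝ), v) i)) = _
  rcases eq_or_ne A B with rfl | h
  · have hrows : (fun i => replaceCoord A p (update (ehat k V) A ((0 : Fin k → ℝ), v) i)) =
        update (fun i => (Pi.single i 1 : Fin k → ℝ)) A (p v • Pi.single A 1) := by
      funext i
      rcases eq_or_ne i A with rfl | hi
      · ext j
        rcases eq_or_ne j i with rfl | hj <;> simp [*]
      · rw [update_of_ne hi, update_of_ne hi, replaceCoord_ehat_of_ne hi]
    rw [hrows, AlternatingMap.map_update_smul,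
      update_eq_self A (fun i => (Pi.single i 1 : Fin k → ℝ)), detRowAlternating_single]
    simp
  · rw [AlternatingMap.map_coord_zero _ A
      (by rw [update_of_ne h, replaceCoord_ehat_self])]
    simp [h.symm]

theorem multimomentumEval_bijective {k : ℕ} (hk : 0 < k) (V : Type*) [AddCommGroup V]
    [Module ℝ V] : Function.Bijective (multimomentumEval k V) := by
  constructor
  · refine (injective_iff_map_eq_zero _).2 fun α hα => Subtype.ext ?_
    refine Wsub_eq_zero hk α.2 (congrArg Prod.fst hα) fun A v => ?_
    exact DFunLike.congr_fun (congrFun (congrArg Prod.snd hα) A) v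
  · rintro ⟨r, p⟩
    refine ⟨r • ⟨_, detRowAlternating_comp_fst_mem_Wsub k V⟩ +
      ∑ A, ⟨_, detRowAlternating_comp_replaceCoord_mem_Wsub A (p A)⟩, ?_⟩
    simp only [map_add, map_smul, map_sum, multimomentumEval_comp_fst,
      multimomentumEval_comp_replaceCoord]
    ext <;> simp [Prod.fst_sum, Prod.snd_sum, Finset.univ_sum_single]

/-- The fiberwise content of ℳπ = Λ₂ᵏT*(ℝᵏ × Q) ≃ ℝᵏ × ℝ × (T¹ₖ)*Q: the linear
map Φ : W → ℝ × (Fin k → V*), Φ(α) = (α(ê₁,…,ê_k), A ↦ (v ↦ α(ê₁,…,(0,v),…,ê_k))),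
is a linear isomorphism. -/
theorem extended_multimomentum_fiber_iso
    (k : ℕ) (hk : 0 < k) (V : Type*) [AddCommGroup V] [Module ℝ V]
    [FiniteDimensional ℝ V] :
    ∃ e : Wsub k V ≃ₗ[ℝ] ℝ × (Fin k → (V →ₗ[ℝ] ℝ)),
      ∀ α : Wsub k V,
        (e α).1 = α.1 (ehat k V) ∧
        ∀ (A : Fin k) (v : V),
          (e α).2 A v = α.1 (Function.update (ehat k V) A ((0 : Fin k → ℝ), v)) := by
  exact ⟨LinearEquiv.ofBijective _ (multimomentumEval_bijective hk V),
    fun _ => ⟨rfl, fun _ _ => rfl⟩⟩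
end
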